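/- Let H be a finite tree on vertex set ι (a connected acyclic finite simple graph), and for every i ∈ ι let G_i be a connected finite simple graph with property (P), with an arbitrarily chosen bail vertex b_i in G_i. Then the threaded union T_H[𝒢] of the family 𝒢 = {(G_i, b_i)} over H has property (P), for every choice of bail vertices. -/

import Mathlib

open Matrix SimpleGraph

/-- A finite simple graph `G` has property (P) if there is a real symmetric matrix `A`
whose off-diagonal support is exactly the edge set of `G`, with `det A ≠ 0`, and such that
every principal submatrix obtained by deleting one row/column is singular. -/
def HasPropertyP {V : Type*} [Finite V] (G : SimpleGraph V) : Prop :=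
  letI : Fintype V := Fintype.ofFinite V
  letI : DecidableEq V := Classical.decEq V
  ∃ A : Matrix V V ℝ, A.IsSymm ∧
    (∀ u v : V, u ≠ v → (A u v ≠ 0 ↔ G.Adj u v)) ∧
    A.det ≠ 0 ∧
    ∀ v : V,
      (A.submatrix (fun x : {x : V // x ≠ v} => (x : V))
        (fun x : {x : V // x ≠ v} => (x : V))).det = 0


/-- The threaded union of the family of graphs `G i` (with bail vertices `b i`) over the
graph `H`: vertices `⟨i, x⟩` and `⟨j, y⟩` are adjacent iff either `i = j` and `x, y` are
adjacent in `G i`, or `i ≠ j`, `i` and `j` are adjacent in `H`, `x = b i` and `y = b j`. -/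
def threadedUnion {ι : Type*} (H : SimpleGraph ι) {V : ι → Type*}
    (G : ∀ i, SimpleGraph (V i)) (b : ∀ i, V i) : SimpleGraph (Σ i, V i) :=
  SimpleGraph.fromRel fun x y =>
    (∃ (i : ι) (u v : V i), (G i).Adj u v ∧ x = ⟨i, u⟩ ∧ y = ⟨i, v⟩) ∨
    (x.1 ≠ y.1 ∧ H.Adj x.1 y.1 ∧ x.2 = b x.1 ∧ y.2 = b y.1)

/-- The principal minor obtained by deleting `v` is a diagonal entry of the adjugate. -/
lemma adjugate_diag_eq {V : Type*} [Fintype V] [DecidableEq V] (A : Matrix V V ℝ) (v : V) :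
    A.adjugate v v = (A.submatrix (fun x : {x : V // x ≠ v} => (x : V))
        (fun x : {x : V // x ≠ v} => (x : V))).det := by
  rw [Matrix.adjugate_apply, Matrix.twoBlockTriangular_det _ (fun i => i ≠ v)]
  · have h2 : (Matrix.toSquareBlockProp (A.updateRow v (Pi.single v 1))
        (fun i => ¬ (i ≠ v))).det = 1 := by
      have : Matrix.toSquareBlockProp (A.updateRow v (Pi.single v 1))
        (fun i => ¬ (i ≠ v)) = 1 := by
        ext ⟨i, hi⟩ ⟨j, hj⟩
        have hi' : i = v := not_not.mp hi
        have hj' : j = v := not_not.mp hj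
        subst hi'
        subst hj'
        simp [Matrix.toSquareBlockProp]
      rw [this, Matrix.det_one]
    rw [h2, mul_one]
    congr 1
    ext ⟨i, hi⟩ ⟨j, hj⟩
    simp [Matrix.toSquareBlockProp, Matrix.updateRow_ne hi]
  · intro i hi j hj
    have hi' : i = v := not_not.mp hi
    subst hi'
    simp [Pi.single_eq_of_ne hj]

/-- For invertible `A` with two-sided inverse `B`, minors vanish iff the diagonal of `B` does. -/
lemma minor_eq {V : Type*} [Fintype V] [DecidableEq V] (A B : Matrix V V ℝ)
    (h : A * B = 1) (v : V) :
    (A.submatrix (fun x : {x : V // x ≠ v} => (x : V))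
        (fun x : {x : V // x ≠ v} => (x : V))).det = A.det * B v v := by
  rw [← adjugate_diag_eq]
  have h1 : A.adjugate = A.det • B := by
    calc A.adjugate = A.adjugate * (A * B) := by rw [h, mul_one]
      _ = A.det • B := by rw [← mul_assoc, Matrix.adjugate_mul, smul_mul_assoc, one_mul]
  rw [h1]; simp

lemma hasPropertyP_iff {V : Type*} [Fintype V] [DecidableEq V] (G : SimpleGraph V) :
    HasPropertyP G ↔ ∃ A B : Matrix V V ℝ, A.IsSymm ∧
      (∀ u v : V, u ≠ v → (A u v ≠ 0 ↔ G.Adj u v)) ∧ A * B = 1 ∧ ∀ v, B v v = 0 := by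
  unfold HasPropertyP
  have e1 : Fintype.ofFinite V = ‹Fintype V› := Subsingleton.elim _ _
  have e2 : Classical.decEq V = ‹DecidableEq V› := Subsingleton.elim _ _
  rw [e1, e2]
  constructor
  · rintro ⟨A, hs, hA, hd, hm⟩
    have hAB : A * A⁻¹ = 1 := Matrix.mul_nonsing_inv _ (isUnit_iff_ne_zero.mpr hd)
    refine ⟨A, A⁻¹, hs, hA, hAB, fun v => ?_⟩
    have := hm v
    erw [minor_eq A _ hAB v] at this
    exact (mul_eq_zero.mp this).resolve_left hd
  · rintro ⟨A, B, hs, hA, hAB, hB⟩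
    refine ⟨A, hs, hA, ?_, fun v => ?_⟩
    · intro h0
      have := congrArg Matrix.det hAB
      simp [h0] at this
    · erw [minor_eq A _ hAB v]
      rw [hB, mul_zero]

/-- If `H` is a finite tree and each `G i` is a connected graph with property (P), then
the threaded union of the `G i` over `H` has property (P), for every choice of bail
vertices. -/
theorem stmt_12 {ι : Type*} [Finite ι] (H : SimpleGraph ι) (htree : H.IsTree)
    {V : ι → Type*} [∀ i, Finite (V i)] (G : ∀ i, SimpleGraph (V i))
    (hGconn : ∀ i, (G i).Connected) (hGP : ∀ i, HasPropertyP (G i))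
    (b : ∀ i, V i) :
    HasPropertyP (threadedUnion H G b) := by
  classical
  letI : Fintype ι := Fintype.ofFinite ι
  letI : ∀ i, Fintype (V i) := fun i => Fintype.ofFinite (V i)
  choose A B hs hA hAB hB using fun i => (hasPropertyP_iff (G i)).mp (hGP i)
  refine (hasPropertyP_iff _).mpr ?_
  set D := Matrix.blockDiagonal' A with hD
  set C := Matrix.blockDiagonal' B with hC
  let E : Matrix (Σ i, V i) (Σ i, V i) ℝ := Matrix.of fun p q =>
    if H.Adj p.1 q.1 ∧ p.2 = b p.1 ∧ q.2 = b q.1 then 1 else 0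
  have hE : ∀ p q, E p q = if H.Adj p.1 q.1 ∧ p.2 = b p.1 ∧ q.2 = b q.1 then 1 else 0 :=
    fun p q => rfl
  have hDC : D * C = 1 := by
    rw [hD, hC, ← Matrix.blockDiagonal'_mul]
    simp only [hAB]
    exact Matrix.blockDiagonal'_one
  have hECE : E * C * E = 0 := by
    ext a c
    rw [Matrix.mul_apply]
    refine Finset.sum_eq_zero fun q _ => ?_
    rw [Matrix.mul_apply, Finset.sum_mul]
    refine Finset.sum_eq_zero fun p _ => ?_
    obtain ⟨i, x⟩ := p
    obtain ⟨j, y⟩ := q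
    by_cases hij : i = j
    · subst hij
      by_cases hx : x = b i
      · by_cases hy : y = b i
        · subst hx
          subst hy
          rw [hC, Matrix.blockDiagonal'_apply_eq, hB]; ring
        · rw [hE ⟨i, y⟩ c, if_neg (fun h => hy h.2.1)]; ring
      · rw [hE a ⟨i, x⟩, if_neg (fun h => hx h.2.2)]; ring
    · rw [hC, Matrix.blockDiagonal'_apply_ne _ _ _ hij]; ring
  refine ⟨D + E, C - C * E * C, ?_, ?_, ?_, ?_⟩
  · refine Matrix.IsSymm.add ?_ ?_
    · unfold Matrix.IsSymm
      rw [hD, Matrix.blockDiagonal'_transpose]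
      congr 1
      funext i
      exact hs i
    · ext p q
      rw [Matrix.transpose_apply, hE, hE]
      congr 1
      rw [H.adj_comm]
      exact propext (by tauto)
  · rintro ⟨i, x⟩ ⟨j, y⟩ huv
    by_cases hij : i = j
    · subst hij
      have hxy : x ≠ y := fun h => huv (by rw [h])
      rw [Matrix.add_apply, hE, hD, Matrix.blockDiagonal'_apply_eq,
        if_neg (fun h => H.loopless.irrefl _ h.1), add_zero, hA i x y hxy]
      simp only [threadedUnion, SimpleGraph.fromRel_adj]
      constructor
      · intro h
        exact ⟨huv, Or.inl (Or.inl ⟨i, x, y, h, rfl, rfl⟩)⟩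
      · rintro ⟨-, (⟨k, u, v, h, h1, h2⟩ | h) | (⟨k, u, v, h, h1, h2⟩ | h)⟩
        · cases h1; cases h2; exact h
        · exact absurd rfl h.1
        · cases h1; cases h2; exact h.symm
        · exact absurd rfl h.1
    · rw [Matrix.add_apply, hE, hD, Matrix.blockDiagonal'_apply_ne _ _ _ hij, zero_add]
      simp only [threadedUnion, SimpleGraph.fromRel_adj]
      constructor
      · intro h
        have h' : H.Adj i j ∧ x = b i ∧ y = b j := by
          by_contra hn
          exact h (if_neg hn)
        exact ⟨huv, Or.inl (Or.inr ⟨hij, h'⟩)⟩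
      · rintro ⟨-, (⟨k, u, v, h, h1, h2⟩ | h) | (⟨k, u, v, h, h1, h2⟩ | h)⟩
        · cases h1; cases h2; exact absurd rfl hij
        · rw [if_pos h.2]; exact one_ne_zero
        · cases h1; cases h2; exact absurd rfl hij
        · rw [if_pos ⟨h.2.1.symm, h.2.2.2, h.2.2.1⟩]; exact one_ne_zero
  · have h1 : D * (C * E * C) = E * C := by
      rw [← mul_assoc, ← mul_assoc, hDC, one_mul]
    have h2 : E * (C * E * C) = 0 := by
      rw [← mul_assoc, ← mul_assoc, hECE, zero_mul]
    rw [mul_sub, add_mul, add_mul, h1, h2, hDC]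
    abel
  · rintro ⟨k, z⟩
    have h0 : (C * E * C) ⟨k, z⟩ ⟨k, z⟩ = 0 := by
      rw [Matrix.mul_apply]
      refine Finset.sum_eq_zero fun q _ => ?_
      rw [Matrix.mul_apply, Finset.sum_mul]
      refine Finset.sum_eq_zero fun p _ => ?_
      obtain ⟨i, x⟩ := p
      obtain ⟨j, y⟩ := q
      by_cases hi : k = i
      · by_cases hj : j = k
        · rw [hE, if_neg (fun h => h.1.ne (hi.symm.trans hj.symm))]; ring
        · rw [hC, Matrix.blockDiagonal'_apply_ne _ _ _ hj]; ring
      · rw [hC, Matrix.blockDiagonal'_apply_ne _ _ _ hi]; ring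
    rw [Matrix.sub_apply, h0, hC, Matrix.blockDiagonal'_apply_eq, hB, sub_zero]
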